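/- Let $B=(b_{ij})$ be an $L\times L$ real matrix with all entries positive and let $c\in\mathbb{R}^L$ have all entries positive. Define the map $T$ on positive vectors by $T_l(z) = c_l\Big/\Big(\sum_{i=1}^L c_i\, b_{il}\big/\big(\sum_{j=1}^L b_{ij}z_j\big)\Big)$. If $z$ and $z'$ are entrywise-positive vectors with $T(z)=z$ and $T(z')=z'$, then there exists $t>0$ such that $z' = t\,z$; that is, the fixed points of $T$ in the positive cone form a single ray. -/

import Mathlib

open Matrix BigOperators

/-- The iteration map `T_l(z) = c_l / (∑ i, c_i b_{il} / (∑ j, b_{ij} z_j))` of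
Lemma 1 / Algorithm 1. -/
noncomputable def Tmap {L : ℕ} (B : Matrix (Fin L) (Fin L) ℝ) (c : Fin L → ℝ)
    (z : Fin L → ℝ) (l : Fin L) : ℝ :=
  c l / (∑ i, c i * B i l / (∑ j, B i j * z j))

/-- `Tmap` is strictly monotone in the sense that if `t • z ≤ w` with strict inequality in some
coordinate, then `t * T z < T w` in every coordinate. -/
theorem mul_Tmap_lt_Tmap {L : ℕ} {B : Matrix (Fin L) (Fin L) ℝ} {c : Fin L → ℝ}
    (hB : ∀ i j, 0 < B i j) (hc : ∀ i, 0 < c i) {z w : Fin L → ℝ} (hz : ∀ j, 0 < z j)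
    {t : ℝ} (ht : 0 < t) (hle : ∀ j, t * z j ≤ w j) (hlt : ∃ j, t * z j < w j) (l : Fin L) :
    t * Tmap B c z l < Tmap B c w l := by
  have hne : (Finset.univ : Finset (Fin L)).Nonempty := ⟨l, Finset.mem_univ l⟩
  have hpos : ∀ i, 0 < ∑ j, B i j * z j := fun i =>
    Finset.sum_pos (fun j _ => mul_pos (hB i j) (hz j)) hne
  have hsum : ∀ i, t * ∑ j, B i j * z j < ∑ j, B i j * w j := by
    intro i
    obtain ⟨j, hj⟩ := hlt
    rw [Finset.mul_sum]
    refine Finset.sum_lt_sum (fun k _ => ?_) ⟨j, Finset.mem_univ j, ?_⟩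
    · nlinarith [mul_le_mul_of_nonneg_left (hle k) (hB i k).le]
    · nlinarith [mul_lt_mul_of_pos_left hj (hB i j)]
  have hnum : ∀ i, 0 < c i * B i l := fun i => mul_pos (hc i) (hB i l)
  have hwpos : ∀ i, 0 < ∑ j, B i j * w j := fun i => (mul_pos ht (hpos i)).trans (hsum i)
  have hden : t * ∑ i, c i * B i l / (∑ j, B i j * w j) <
      ∑ i, c i * B i l / (∑ j, B i j * z j) := by
    rw [Finset.mul_sum]
    refine Finset.sum_lt_sum_of_nonempty hne fun i _ => ?_
    rw [← mul_div_assoc, div_lt_div_iff₀ (hwpos i) (hpos i)]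
    nlinarith [mul_lt_mul_of_pos_left (hsum i) (hnum i)]
  have hdw : 0 < ∑ i, c i * B i l / (∑ j, B i j * w j) :=
    Finset.sum_pos (fun i _ => div_pos (hnum i) (hwpos i)) hne
  have hdz : 0 < ∑ i, c i * B i l / (∑ j, B i j * z j) := (mul_pos ht hdw).trans hden
  unfold Tmap
  rw [← mul_div_assoc, div_lt_div_iff₀ hdz hdw]
  nlinarith [mul_lt_mul_of_pos_left hden (hc l)]

/-- The fixed points of the iteration map `T` in the positive cone form a single ray:
any two entrywise-positive fixed points are positive multiples of one another. -/
theorem stmt5 {L : ℕ} (B : Matrix (Fin L) (Fin L) ℝ) (c : Fin L → ℝ)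
    (hB : ∀ i j, 0 < B i j) (hc : ∀ i, 0 < c i)
    (z z' : Fin L → ℝ) (hz : ∀ j, 0 < z j) (hz' : ∀ j, 0 < z' j)
    (hfix : ∀ l, Tmap B c z l = z l) (hfix' : ∀ l, Tmap B c z' l = z' l) :
    ∃ t : ℝ, 0 < t ∧ ∀ l, z' l = t * z l := by
  rcases isEmpty_or_nonempty (Fin L) with _ | _
  · exact ⟨1, one_pos, fun l => isEmptyElim l⟩
  obtain ⟨m, hm⟩ := Finite.exists_min fun j => z' j / z j
  have ht : 0 < z' m / z m := div_pos (hz' m) (hz m)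
  have hle : ∀ j, z' m / z m * z j ≤ z' j := fun j => (le_div_iff₀ (hz j)).1 (hm j)
  refine ⟨z' m / z m, ht, fun l => ?_⟩
  by_contra hl
  have h := mul_Tmap_lt_Tmap hB hc hz ht hle ⟨l, lt_of_le_of_ne (hle l) (Ne.symm hl)⟩ m
  rw [hfix, hfix', div_mul_cancel₀ _ (hz m).ne'] at h
  exact lt_irrefl _ h
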